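/- arXiv:1101.1536 — 3 statements merged into one kernel-verified Lean document; each statement's English description precedes it below -/
import Mathlib

section
/- Let E and F be bracketing functions on {1,…,n}. Then the meet of I_E and I_F in the permutation lattice Sₙ equals the intersection I_E ∩ I_F; that is, I_E ∩ I_F is the inversion set of a permutation and is the largest inversion set contained in both I_E and I_F. -/
/-- The inversion set of a permutation `σ` of `Fin n`: pairs `(a, b)` with `a > b`
such that `a` precedes `b` in the word `σ(1) σ(2) ⋯ σ(n)`, i.e. `σ⁻¹ a < σ⁻¹ b`. -/
def InvSet (n : ℕ) (σ : Equiv.Perm (Fin n)) : Set (Fin n × Fin n) :=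
  {p | p.2 < p.1 ∧ σ.symm p.1 < σ.symm p.2}

/-- `A` is the inversion set of some permutation of `Fin n`. -/
def IsInvSet (n : ℕ) (A : Set (Fin n × Fin n)) : Prop :=
  ∃ σ : Equiv.Perm (Fin n), A = InvSet n σ

/-- Condition (I1): `A` is transitive. -/
def CondI1 {n : ℕ} (A : Set (Fin n × Fin n)) : Prop :=
  ∀ a b c : Fin n, (a, b) ∈ A → (b, c) ∈ A → (a, c) ∈ A

/-- Condition (I2): if `b < c < a` and `(a, b) ∈ A`, then `(a, c) ∈ A` or `(c, b) ∈ A`. -/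
def CondI2 {n : ℕ} (A : Set (Fin n × Fin n)) : Prop :=
  ∀ a b c : Fin n, b < c → c < a → (a, b) ∈ A → (a, c) ∈ A ∨ (c, b) ∈ A

/-- Condition (I2)*: if `b < c < a` and `(a, b) ∈ A`, then `(c, b) ∈ A`. -/
def CondI2Star {n : ℕ} (A : Set (Fin n × Fin n)) : Prop :=
  ∀ a b c : Fin n, b < c → c < a → (a, b) ∈ A → (c, b) ∈ A

/-- A bracketing function on `Fin n`: (E1) `k ≤ E k`, and
(E2) if `k ≤ j ≤ E k` then `E j ≤ E k`. -/
def IsBracketing {n : ℕ} (E : Fin n → Fin n) : Prop :=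
  (∀ k, k ≤ E k) ∧ ∀ k j, k ≤ j → j ≤ E k → E j ≤ E k

/-- The set of pairs `I_E = {(a, k) : k < a ≤ E k}` associated to a bracketing function. -/
def IE {n : ℕ} (E : Fin n → Fin n) : Set (Fin n × Fin n) :=
  {p | p.2 < p.1 ∧ p.1 ≤ E p.2}

/-- The transitive closure of a set of pairs. -/
def TrCl {n : ℕ} (A : Set (Fin n × Fin n)) : Set (Fin n × Fin n) :=
  {p | Relation.TransGen (fun a b => (a, b) ∈ A) p.1 p.2}
/-- The pointwise minimum of two bracketing functions is a bracketing function. -/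
theorem IsBracketing.inf {n : ℕ} {E F : Fin n → Fin n} (hE : IsBracketing E)
    (hF : IsBracketing F) : IsBracketing (E ⊓ F) :=
  ⟨fun k => le_inf (hE.1 k) (hF.1 k), fun k j hkj hj =>
    inf_le_inf (hE.2 k j hkj (hj.trans inf_le_left)) (hF.2 k j hkj (hj.trans inf_le_right))⟩

theorem IE_inf {n : ℕ} (E F : Fin n → Fin n) : IE (E ⊓ F) = IE E ∩ IE F := by
  ext p
  simp only [IE, Set.mem_inter_iff, Set.mem_ofPred_eq, Pi.inf_apply, le_inf_iff]
  tauto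

theorem IsBracketing.condI1_IE {n : ℕ} {E : Fin n → Fin n} (hE : IsBracketing E) :
    CondI1 (IE E) := by
  rintro a b c ⟨hba, ha⟩ ⟨hcb, hb⟩
  exact ⟨hcb.trans hba, ha.trans (hE.2 c b hcb.le hb)⟩

theorem condI2_IE {n : ℕ} (E : Fin n → Fin n) : CondI2 (IE E) := by
  rintro a b c hbc hca ⟨_, ha⟩
  exact Or.inr ⟨hbc, hca.le.trans ha⟩

/-- A strict total order on `Fin n` is the order in which the letters of some permutation
appear. -/
theorem exists_perm_symm_lt_iff {n : ℕ} (r : Fin n → Fin n → Prop) [IsStrictTotalOrder (Fin n) r] :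
    ∃ σ : Equiv.Perm (Fin n), ∀ a b, σ.symm a < σ.symm b ↔ r a b := by
  classical
  let rank : Fin n → Fin n := fun x =>
    ⟨(Finset.univ.filter fun y => r y x).card, by
      have h : (Finset.univ.filter fun y => r y x) ⊂ Finset.univ :=
        Finset.filter_ssubset.2 ⟨x, Finset.mem_univ x, irrefl x⟩
      simpa using Finset.card_lt_card h⟩
  have rank_lt : ∀ a b, r a b → rank a < rank b := by
    intro a b hab
    refine Fin.mk_lt_mk.2 (Finset.card_lt_card ?_)
    rw [Finset.ssubset_iff_of_subset]
    · exact ⟨a, by simpa using hab, by simpa using irrefl a⟩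
    · intro y hy
      simp only [Finset.mem_filter, Finset.mem_univ, true_and] at hy ⊢
      exact _root_.trans hy hab
  have rank_lt_iff : ∀ a b, rank a < rank b ↔ r a b := by
    refine fun a b => ⟨fun h => ?_, rank_lt a b⟩
    rcases trichotomous_of r a b with hab | rfl | hba
    · exact hab
    · exact absurd h (lt_irrefl _)
    · exact absurd h (rank_lt b a hba).asymm
  have rank_inj : Function.Injective rank := by
    intro a b hab
    rcases trichotomous_of r a b with h | h | h
    · exact absurd hab (rank_lt a b h).ne
    · exact h
    · exact absurd hab (rank_lt b a h).ne'
  exact ⟨(Equiv.ofBijective rank (Finite.injective_iff_bijective.1 rank_inj)).symm, rank_lt_iff⟩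

/-- A set of pairs `(a, b)` with `b < a` satisfying (I1) and (I2) is an inversion set. -/
theorem isInvSet_of_condI1_condI2 {n : ℕ} {A : Set (Fin n × Fin n)}
    (hlt : ∀ a b, (a, b) ∈ A → b < a) (h1 : CondI1 A) (h2 : CondI2 A) : IsInvSet n A := by
  let r : Fin n → Fin n → Prop := fun x y => (x, y) ∈ A ∨ (x < y ∧ (y, x) ∉ A)
  have hr : IsStrictTotalOrder (Fin n) r :=
    { trichotomous := by
        intro a b hab hba
        rcases lt_trichotomy a b with h | h | h <;> grind
      irrefl := by
        rintro a (h | h)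
        · exact lt_irrefl a (hlt a a h)
        · exact lt_irrefl a h.1
      trans := by
        rintro a b c (hab | ⟨hab, hba⟩) (hbc | ⟨hbc, hcb⟩)
        · exact Or.inl (h1 a b c hab hbc)
        · have := hlt a b hab
          rcases lt_trichotomy a c with h | rfl | h
          · exact Or.inr ⟨h, fun hca => hcb (h1 c a b hca hab)⟩
          · exact absurd hab hcb
          · exact Or.inl ((h2 a b c hbc h hab).resolve_right hcb)
        · have := hlt b c hbc
          rcases lt_trichotomy a c with h | rfl | h
          · exact Or.inr ⟨h, fun hca => hba (h1 b c a hbc hca)⟩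
          · exact absurd hbc hba
          · exact Or.inl ((h2 b c a h hab hbc).resolve_left hba)
        · exact Or.inr ⟨hab.trans hbc, fun hca => (h2 c a b hab hbc hca).elim hcb hba⟩ }
  obtain ⟨σ, hσ⟩ := exists_perm_symm_lt_iff r
  refine ⟨σ, Set.ext fun ⟨a, b⟩ => ?_⟩
  simp only [InvSet, Set.mem_ofPred_eq, hσ]
  exact ⟨fun h => ⟨hlt a b h, Or.inl h⟩,
    fun ⟨hba, h⟩ => h.resolve_right fun hab => hba.asymm hab.1⟩

theorem IsBracketing.isInvSet_IE {n : ℕ} {E : Fin n → Fin n} (hE : IsBracketing E) :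
    IsInvSet n (IE E) :=
  isInvSet_of_condI1_condI2 (fun _ _ h => h.1) hE.condI1_IE (condI2_IE E)

/-- For bracketing functions `E, F`, the intersection `I_E ∩ I_F` is an inversion set
and is the largest inversion set contained in both, i.e. the meet of `I_E` and `I_F`
in the permutation lattice `Sₙ`. -/
theorem stmt_6 (n : ℕ) (E F : Fin n → Fin n) (hE : IsBracketing E) (hF : IsBracketing F) :
    IsInvSet n (IE E ∩ IE F) ∧
    IE E ∩ IE F ⊆ IE E ∧ IE E ∩ IE F ⊆ IE F ∧
    ∀ C : Set (Fin n × Fin n), IsInvSet n C → C ⊆ IE E → C ⊆ IE F → C ⊆ IE E ∩ IE F := by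
  refine ⟨?_, Set.inter_subset_left, Set.inter_subset_right, fun _ _ => Set.subset_inter⟩
  rw [← IE_inf]
  exact (hE.inf hF).isInvSet_IE
end

section
/- Let E and F be bracketing functions on {1,…,n}. Then the transitive closure (I_E ∪ I_F)^tr satisfies conditions (I1) and (I2)*; consequently the join of I_E and I_F in the permutation lattice Sₙ satisfies (I2)*. -/
/-- The union of two sets of the form `I_E` satisfies (I2)*. -/
theorem condI2Star_IE_union {n : ℕ} (E F : Fin n → Fin n) : CondI2Star (IE E ∪ IE F) := by
  rintro a b c hbc hca (h | h)
  · exact Or.inl ⟨hbc, hca.le.trans h.2⟩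
  · exact Or.inr ⟨hbc, hca.le.trans h.2⟩

theorem condI1_trCl {n : ℕ} (A : Set (Fin n × Fin n)) : CondI1 (TrCl A) :=
  fun _ _ _ hab hbc => Relation.TransGen.trans hab hbc

/-- The transitive closure preserves (I2)*. -/
theorem CondI2Star.trCl {n : ℕ} {A : Set (Fin n × Fin n)} (hA : CondI2Star A) :
    CondI2Star (TrCl A) := by
  intro a b c hbc hca hab
  change Relation.TransGen (fun a b => (a, b) ∈ A) a b at hab
  change Relation.TransGen (fun a b => (a, b) ∈ A) c b
  induction hab with
  | single h => exact .single (hA _ _ _ hbc hca h)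
  | @tail m b _ hmb ih =>
    rcases lt_trichotomy c m with hcm | rfl | hmc
    · exact .single (hA _ _ _ hbc hcm hmb)
    · exact .single hmb
    · exact (ih hmc).tail hmb

/-- For bracketing functions `E, F`, the transitive closure `(I_E ∪ I_F)^tr` (which is
the join of `I_E` and `I_F` in `Sₙ`) satisfies (I1) and (I2)*. -/
theorem stmt_7 (n : ℕ) (E F : Fin n → Fin n) (hE : IsBracketing E) (hF : IsBracketing F) :
    CondI1 (TrCl (IE E ∪ IE F)) ∧ CondI2Star (TrCl (IE E ∪ IE F)) := by
  exact ⟨condI1_trCl _, (condI2Star_IE_union E F).trCl⟩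
end

section
/- The image of the map E ↦ I_E, over all bracketing functions E on {1,…,n}, is exactly the set of those inversion sets of permutations of {1,…,n} that satisfy condition (I2)* (if b<c<a and (a,b) is in the set then (c,b) is in the set). -/
/-- Condition (I1) holds for the inversion set of a permutation. -/
theorem condI1_invSet (n : ℕ) (σ : Equiv.Perm (Fin n)) : CondI1 (InvSet n σ) :=
  fun _ _ _ h₁ h₂ => ⟨h₂.1.trans h₁.1, h₁.2.trans h₂.2⟩

/-- A transitive set of decreasing pairs satisfying (I2)* comes from a bracketing function. -/
theorem CondI2Star.exists_isBracketing {n : ℕ} {A : Set (Fin n × Fin n)} (h : CondI2Star A)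
    (htrans : CondI1 A) (hlt : ∀ a b : Fin n, (a, b) ∈ A → b < a) :
    ∃ E : Fin n → Fin n, IsBracketing E ∧ A = IE E := by
  have hmax : ∀ k : Fin n, ∃ m, (m = k ∨ (m, k) ∈ A) ∧ ∀ a, (a = k ∨ (a, k) ∈ A) → a ≤ m := by
    intro k
    obtain ⟨m, hm, hmax⟩ := Set.exists_max_image {a : Fin n | a = k ∨ (a, k) ∈ A} id
      (Set.toFinite _) ⟨k, Or.inl rfl⟩
    exact ⟨m, hm, hmax⟩
  choose E hE hEmax using hmax
  have hmem : ∀ a k, (a, k) ∈ A ↔ k < a ∧ a ≤ E k := by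
    refine fun a k => ⟨fun ha => ⟨hlt a k ha, hEmax k a (Or.inr ha)⟩, fun ⟨hka, hak⟩ => ?_⟩
    rcases hE k with hk | hk
    · exact absurd (hka.trans_le hak) (by simp [hk])
    · rcases hak.eq_or_lt with rfl | hlt'
      · exact hk
      · exact h _ _ _ hka hlt' hk
  refine ⟨E, ⟨fun k => hEmax k k (Or.inl rfl), fun k j hkj hj => ?_⟩, ?_⟩
  · rcases hkj.eq_or_lt with rfl | hkj
    · exact le_rfl
    · rcases hE j with hEj | hEj
      · rwa [hEj]
      · exact hEmax k _ (Or.inr (htrans _ _ _ hEj ((hmem j k).2 ⟨hkj, hj⟩)))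
  · ext ⟨a, k⟩
    exact hmem a k

theorem condI2Star_IE {n : ℕ} (E : Fin n → Fin n) : CondI2Star (IE E) :=
  fun _ _ _ hbc hca h => ⟨hbc, hca.le.trans h.2⟩

/-- The image of the map `E ↦ I_E` over all bracketing functions is exactly the set of
inversion sets of permutations satisfying (I2)*. -/
theorem stmt_13 (n : ℕ) :
    {A : Set (Fin n × Fin n) | ∃ E : Fin n → Fin n, IsBracketing E ∧ A = IE E} =
    {A : Set (Fin n × Fin n) | IsInvSet n A ∧ CondI2Star A} := by
  ext A
  constructor
  · rintro ⟨E, hE, rfl⟩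
    exact ⟨hE.isInvSet_IE, condI2Star_IE E⟩
  · rintro ⟨⟨σ, rfl⟩, h⟩
    exact h.exists_isBracketing (condI1_invSet n σ) fun _ _ hp => hp.1
end
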